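/- Let μ ∈ (0,1) and let (x₀, 0) with x₀ ∉ {−μ, 1−μ} be a critical point of the effective potential U (a collinear Lagrange point). Then (x₀, 0) is a saddle point of U in the sense that the second partial derivatives satisfy ∂²U/∂x²(x₀, 0) > 0 and ∂²U/∂y²(x₀, 0) < 0; equivalently, at (x₀, 0) one has (1−μ)/r₁³ + μ/r₂³ > 1. -/

import Mathlib

theorem hasDerivAt_div_sqrt_sq_pow_three {c a : ℝ} (h : a + c ≠ 0) :
    HasDerivAt (fun t : ℝ => (t + c) / Real.sqrt ((t + c) ^ 2 + 0 ^ 2) ^ 3)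
      (-2 / |a + c| ^ 3) a := by
  have hpos : 0 < |a + c| := abs_pos.mpr h
  have hs : Real.sqrt ((a + c) ^ 2 + 0 ^ 2) = |a + c| := by
    simp [Real.sqrt_sq_eq_abs]
  have h1 : HasDerivAt (fun t : ℝ => t + c) 1 a := (hasDerivAt_id a).add_const c
  have h2 := ((h1.fun_pow 2).add_const ((0 : ℝ) ^ 2)).sqrt (by positivity)
  have h3 := h1.fun_div (h2.fun_pow 3) (by rw [hs]; positivity)
  refine h3.congr_deriv ?_
  simp only [hs]
  field_simp
  push_cast
  linear_combination 6 * |a + c| ^ 2 * sq_abs (a + c)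

theorem hasDerivAt_div_sqrt_sq_add_sq_pow_three {c : ℝ} (h : c ≠ 0) :
    HasDerivAt (fun t : ℝ => t / Real.sqrt (c ^ 2 + t ^ 2) ^ 3) (1 / |c| ^ 3) 0 := by
  have hpos : 0 < |c| := abs_pos.mpr h
  have hs : Real.sqrt (c ^ 2 + 0 ^ 2) = |c| := by
    simp [Real.sqrt_sq_eq_abs]
  have h1 : HasDerivAt (fun t : ℝ => t) 1 0 := hasDerivAt_id 0
  have h2 := ((h1.fun_pow 2).const_add (c ^ 2)).sqrt (by positivity)
  have h3 := h1.fun_div (h2.fun_pow 3) (by rw [hs]; positivity)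
  refine h3.congr_deriv ?_
  simp only [hs]
  field_simp
  ring

/-- At a collinear equilibrium the weighted sum of inverse cubed distances exceeds one.
Here `d` and `d - 1` are the signed displacements from the two primaries. -/
theorem one_lt_of_collinear_equilibrium {μ d : ℝ} (hμ : μ ∈ Set.Ioo (0 : ℝ) 1)
    (hd : d ≠ 0) (he : d - 1 ≠ 0)
    (h : d - μ - (1 - μ) * d / |d| ^ 3 - μ * (d - 1) / |d - 1| ^ 3 = 0) :
    1 < (1 - μ) / |d| ^ 3 + μ / |d - 1| ^ 3 := by
  obtain ⟨hμ0, hμ1⟩ := hμ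
  have hd' : 0 < |d| := abs_pos.mpr hd
  have he' : 0 < |d - 1| := abs_pos.mpr he
  have hinv_lt {x : ℝ} (hx : 1 < x) : (x ^ 3)⁻¹ < 1 :=
    inv_lt_one_of_one_lt₀ (one_lt_pow₀ hx three_ne_zero)
  have hinv_gt {x : ℝ} (hx0 : 0 < x) (hx : x < 1) : 1 < (x ^ 3)⁻¹ :=
    (one_lt_inv₀ (by positivity)).mpr (pow_lt_one₀ hx0.le hx three_ne_zero)
  simp only [div_eq_mul_inv] at h ⊢
  have hA1 : 1 < |d| → (|d| ^ 3)⁻¹ < 1 := hinv_lt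
  have hB1 : 1 < |d - 1| → (|d - 1| ^ 3)⁻¹ < 1 := hinv_lt
  have hB2 : |d - 1| < 1 → 1 < (|d - 1| ^ 3)⁻¹ := hinv_gt he'
  generalize (|d| ^ 3)⁻¹ = A at *
  generalize (|d - 1| ^ 3)⁻¹ = B at *
  have hdK : d * ((1 - μ) * A + μ * B - 1) = μ * (B - 1) := by linear_combination -h
  have heK : (d - 1) * ((1 - μ) * A + μ * B - 1) = (1 - μ) * (1 - A) := by
    linear_combination -h
  rw [← sub_pos]
  rcases lt_or_gt_of_ne hd with hneg | hpos
  · have hB := hB1 (by rw [abs_of_neg (by linarith)]; linarith)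
    exact pos_of_mul_neg_right
      (hdK.trans_lt (mul_neg_of_pos_of_neg hμ0 (by linarith))) hneg.le
  · rcases lt_or_gt_of_ne he with heneg | hepos
    · have hB := hB2 (by rw [abs_of_neg heneg]; linarith)
      exact pos_of_mul_pos_right
        (lt_of_lt_of_eq (mul_pos hμ0 (by linarith)) hdK.symm) hpos.le
    · have hA := hA1 (by rw [abs_of_pos hpos]; linarith)
      exact pos_of_mul_pos_right
        (lt_of_lt_of_eq (mul_pos (by linarith) (by linarith)) heK.symm) hepos.le


/-- Every collinear Lagrange point (x₀, 0) (a critical point of the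
effective potential on the x-axis, away from the primaries) is a saddle point of U:
∂²U/∂x²(x₀,0) > 0 and ∂²U/∂y²(x₀,0) < 0; equivalently, (1−μ)/r₁³ + μ/r₂³ > 1 there. -/
theorem stmt8 (μ : ℝ) (hμ : μ ∈ Set.Ioo (0:ℝ) 1)
    (x₀ : ℝ) (hx₀ : x₀ ≠ -μ ∧ x₀ ≠ 1 - μ)
    (r1 r2 : ℝ → ℝ → ℝ)
    (hr1def : ∀ a b, r1 a b = Real.sqrt ((a + μ)^2 + b^2))
    (hr2def : ∀ a b, r2 a b = Real.sqrt ((a - 1 + μ)^2 + b^2))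
    (U : ℝ → ℝ → ℝ)
    (hU : ∀ a b, U a b = (1/2) * (a^2 + b^2) + (1 - μ) / r1 a b + μ / r2 a b)
    (Ux Uy : ℝ → ℝ → ℝ)
    (hUx : ∀ a b, Ux a b =
      a - (1 - μ) * (a + μ) / (r1 a b)^3 - μ * (a - 1 + μ) / (r2 a b)^3)
    (hUy : ∀ a b, Uy a b =
      b - (1 - μ) * b / (r1 a b)^3 - μ * b / (r2 a b)^3)
    (hcrit : Ux x₀ 0 = 0 ∧ Uy x₀ 0 = 0) :
    0 < deriv (fun a => Ux a 0) x₀ ∧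
    deriv (fun b => Uy x₀ b) 0 < 0 ∧
    1 < (1 - μ) / (r1 x₀ 0)^3 + μ / (r2 x₀ 0)^3 := by
  have hd : x₀ + μ ≠ 0 := fun h => hx₀.1 (by linarith)
  have he : x₀ + (μ - 1) ≠ 0 := fun h => hx₀.2 (by linarith)
  have hshift (a : ℝ) : a - 1 + μ = a + (μ - 1) := by ring
  have hr1 : r1 x₀ 0 = |x₀ + μ| := by simp [hr1def, Real.sqrt_sq_eq_abs]
  have hr2 : r2 x₀ 0 = |x₀ + (μ - 1)| := by simp [hr2def, hshift, Real.sqrt_sq_eq_abs]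
  have key : 1 < (1 - μ) / |x₀ + μ| ^ 3 + μ / |x₀ + (μ - 1)| ^ 3 := by
    have hc := hcrit.1
    rw [hUx, hr1, hr2, hshift] at hc
    have heq : x₀ + μ - 1 = x₀ + (μ - 1) := by ring
    have := one_lt_of_collinear_equilibrium (d := x₀ + μ) hμ hd (by rwa [heq])
      (by rw [heq]; linear_combination hc)
    rwa [heq] at this
  have hx : HasDerivAt (fun a => Ux a 0)
      (1 - (1 - μ) * (-2 / |x₀ + μ| ^ 3) - μ * (-2 / |x₀ + (μ - 1)| ^ 3)) x₀ := by
    simp only [hUx, hr1def, hr2def, hshift, mul_div_assoc]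
    exact ((hasDerivAt_id x₀).sub ((hasDerivAt_div_sqrt_sq_pow_three hd).const_mul _)).sub
      ((hasDerivAt_div_sqrt_sq_pow_three he).const_mul _)
  have hy : HasDerivAt (fun b => Uy x₀ b)
      (1 - (1 - μ) * (1 / |x₀ + μ| ^ 3) - μ * (1 / |x₀ + (μ - 1)| ^ 3)) 0 := by
    simp only [hUy, hr1def, hr2def, hshift, mul_div_assoc]
    exact ((hasDerivAt_id (0 : ℝ)).sub
      ((hasDerivAt_div_sqrt_sq_add_sq_pow_three hd).const_mul _)).sub
      ((hasDerivAt_div_sqrt_sq_add_sq_pow_three he).const_mul _)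
  rw [hx.deriv, hy.deriv, hr1, hr2]
  simp only [div_eq_mul_inv] at key ⊢
  exact ⟨by linarith, by linarith, key⟩
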